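/- Let m ≥ k ≥ 1. Let φ_1,…,φ_m be probability measures on ℝ that are linearly independent as elements of the real vector space of finite signed measures on ℝ, and let ψ be a k×m real matrix with nonnegative entries, rows summing to 1, and rank k. Define the probability measures μ_j = Σ_{ℓ=1}^m ψ_{jℓ} φ_ℓ for j = 1,…,k. Let Q be an invertible k×k row-stochastic matrix and π a probability vector with πQ = π and π_j > 0 for all j. Let Q̃ be any k×k row-stochastic matrix, π̃ a probability vector with π̃Q̃ = π̃, and μ̃_1,…,μ̃_k any probability measures on ℝ. If the measures on ℝ³, Σ_{i=1}^k (Σ_{j=1}^k π_j Q_{j,i} μ_j) ⊗ μ_i ⊗ (Σ_{j=1}^k Q_{i,j} μ_j) and Σ_{i=1}^k (Σ_{j=1}^k π̃_j Q̃_{j,i} μ̃_j) ⊗ μ̃_i ⊗ (Σ_{j=1}^k Q̃_{i,j} μ̃_j), are equal, then there exists a permutation σ of {1,…,k} such that for all i, j: μ̃_i = μ_{σ(i)}, Q̃_{i,j} = Q_{σ(i),σ(j)}, and π̃_i = π_{σ(i)}. -/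

import Mathlib

open MeasureTheory Finset

/-- Mixing linearly independent real functions by a matrix with linearly independent rows preserves
linear independence. -/
theorem LinearIndependent.sum_mul_of_row {ι κ X : Type*} [Fintype ι] [Fintype κ]
    {v : κ → X → ℝ} (hv : LinearIndependent ℝ v)
    {M : Matrix ι κ ℝ} (hM : LinearIndependent ℝ M.row) :
    LinearIndependent ℝ fun i x => ∑ j, M i j * v j x := by
  rw [Fintype.linearIndependent_iff] at hv hM ⊢
  intro g hg
  refine hM g (funext fun j => ?_)
  have h := hv (fun j => ∑ i, g i * M i j) ?_ j
  · simpa [Matrix.row] using h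
  · rw [← hg]
    ext x
    simp only [Finset.sum_apply, Pi.smul_apply, smul_eq_mul, sum_mul, mul_sum, mul_assoc]
    exact sum_comm

theorem LinearIndependent.exists_dual_family {ι V : Type*} [Fintype ι] [DecidableEq ι]
    [AddCommGroup V] [Module ℝ V] {v : ι → V} (hv : LinearIndependent ℝ v) :
    ∃ D : ι → V →ₗ[ℝ] ℝ, ∀ r i, D r (v i) = (1 : Matrix ι ι ℝ) r i := by
  obtain ⟨L, hL⟩ := (Fintype.linearCombination ℝ v).exists_leftInverse_of_injective
    (LinearMap.ker_eq_bot.2 hv.fintypeLinearCombination_injective)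
  refine ⟨fun r => LinearMap.proj r ∘ₗ L, fun r i => ?_⟩
  have h := congrFun (LinearMap.congr_fun hL (Pi.single i 1)) r
  simpa [Fintype.linearCombination_apply_single, Pi.single_apply, Matrix.one_apply] using h

/-- Uniqueness of the middle factors in a decomposition of a trilinear form into `card ι` rank-one
terms whose outer factors are linearly independent. -/
theorem exists_perm_middle_eq {ι X Y Z : Type*} [Fintype ι]
    {a a' : ι → X → ℝ} {b b' : ι → Y → ℝ} {c c' : ι → Z → ℝ} {u : Y}
    (ha : LinearIndependent ℝ a) (hc : LinearIndependent ℝ c)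
    (hb : ∀ i, b i u = 1) (hb' : ∀ i, b' i u = 1)
    (h : ∀ x y z, ∑ i, a i x * b i y * c i z = ∑ i, a' i x * b' i y * c' i z) :
    ∃ σ : Equiv.Perm ι, ∀ i, b' i = b (σ i) := by
  classical
  obtain ⟨D, hD⟩ := ha.exists_dual_family
  obtain ⟨E, hE⟩ := hc.exists_dual_family
  let P : Matrix ι ι ℝ := .of fun r i => D r (a' i)
  let R : Matrix ι ι ℝ := .of fun i s => E s (c' i)
  have h₁ (r y z) : b r y * c r z = ∑ i, P r i * b' i y * c' i z := by
    have hx : ∑ i, (b i y * c i z) • a i = ∑ i, (b' i y * c' i z) • a' i := by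
      ext x
      simpa [mul_comm, mul_assoc, mul_left_comm] using h x y z
    have := congrArg (D r) hx
    simpa [hD, Matrix.one_apply, P, mul_comm, mul_assoc, mul_left_comm] using this
  have h₂ (y) : Matrix.diagonal (fun r => b r y) = P * Matrix.diagonal (fun i => b' i y) * R := by
    ext r s
    have hz : b r y • c r = ∑ i, (P r i * b' i y) • c' i := by
      ext z
      simpa using h₁ r y z
    have := congrArg (E s) hz
    simpa [hE, Matrix.one_apply, Matrix.diagonal_apply, Matrix.mul_apply (N := R),
      R, eq_comm] using this
  have hPR : P * R = 1 := by simpa [hb, hb'] using (h₂ u).symm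
  have hRP : R * P = 1 := mul_eq_one_comm.1 hPR
  have hP : P.det ≠ 0 := P.det_ne_zero_of_right_inverse hPR
  obtain ⟨σ, hσ⟩ : ∃ σ : Equiv.Perm ι, ∀ i, P (σ i) i ≠ 0 := by
    by_contra! hn
    refine hP ?_
    rw [Matrix.det_apply]
    refine sum_eq_zero fun σ _ => ?_
    obtain ⟨i, hi⟩ := hn σ
    rw [prod_eq_zero (f := fun i => P (σ i) i) (mem_univ i) hi, smul_zero]
  refine ⟨σ, fun i => funext fun y => ?_⟩
  have h₃ : Matrix.diagonal (fun r => b r y) * P = P * Matrix.diagonal (fun i => b' i y) := by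
    rw [h₂, Matrix.mul_assoc, hRP, Matrix.mul_one]
  have h₄ := congrFun (congrFun h₃ (σ i)) i
  rw [Matrix.diagonal_mul, Matrix.mul_diagonal, mul_comm] at h₄
  exact (mul_left_cancel₀ (hσ i) h₄).symm

/-- Identifiability of a stationary hidden Markov chain from three consecutive observations, for
emissions given as linearly independent real functions normalised at a point `u`. -/
theorem hmm_identifiability_of_linearIndependent {ι X : Type*} [Fintype ι] [DecidableEq ι]
    {m m' : ι → X → ℝ} {u : X} (hm : LinearIndependent ℝ m)
    (hu : ∀ i, m i u = 1) (hu' : ∀ i, m' i u = 1)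
    {Q Q' : Matrix ι ι ℝ} {p p' : ι → ℝ}
    (hQrow : ∀ i, ∑ j, Q i j = 1) (hQ : Q.det ≠ 0) (hp : ∀ j, p j ≠ 0)
    (hstat : ∀ i, ∑ j, p j * Q j i = p i)
    (hQ'row : ∀ i, ∑ j, Q' i j = 1) (hstat' : ∀ i, ∑ j, p' j * Q' j i = p' i)
    (h : ∀ x y z, ∑ i, (∑ j, p j * Q j i * m j x) * m i y * (∑ j, Q i j * m j z) =
      ∑ i, (∑ j, p' j * Q' j i * m' j x) * m' i y * (∑ j, Q' i j * m' j z)) :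
    ∃ σ : Equiv.Perm ι, (∀ i, m' i = m (σ i)) ∧ (∀ i j, Q' i j = Q (σ i) (σ j)) ∧
      ∀ i, p' i = p (σ i) := by
  have row_of_det {M : Matrix ι ι ℝ} (hM : M.det ≠ 0) : LinearIndependent ℝ M.row :=
    Matrix.linearIndependent_rows_of_det_ne_zero hM
  have hc : LinearIndependent ℝ fun i z => ∑ j, Q i j * m j z := hm.sum_mul_of_row (row_of_det hQ)
  have ha : LinearIndependent ℝ fun i x => ∑ j, p j * Q j i * m j x := by
    have hdet : ((Matrix.diagonal p * Q).transpose).det ≠ 0 := by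
      rw [Matrix.det_transpose, Matrix.det_mul, Matrix.det_diagonal]
      exact mul_ne_zero (prod_ne_zero_iff.2 fun i _ => hp i) hQ
    simpa using hm.sum_mul_of_row (row_of_det hdet)
  obtain ⟨σ, hσ⟩ := exists_perm_middle_eq ha hc hu hu' h
  have hac (i x z) : (∑ j, p j * Q j (σ i) * m j x) * (∑ j, Q (σ i) j * m j z) =
      (∑ j, p' j * Q' j i * m' j x) * (∑ j, Q' i j * m' j z) := by
    have hli := hm.comp σ σ.injective
    rw [Fintype.linearIndependent_iff] at hli
    refine sub_eq_zero.1 (hli (fun i => (∑ j, p j * Q j (σ i) * m j x) *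
      (∑ j, Q (σ i) j * m j z) - (∑ j, p' j * Q' j i * m' j x) * (∑ j, Q' i j * m' j z)) ?_ i)
    ext y
    have hy := h x y z
    rw [← Equiv.sum_comp σ] at hy
    simp only [← hσ] at hy
    simp only [Function.comp_apply, sub_smul, sum_sub_distrib, Pi.sub_apply, Finset.sum_apply,
      Pi.smul_apply, smul_eq_mul, Pi.zero_apply, ← hσ, sub_eq_zero]
    simpa only [mul_right_comm] using hy
  have hpp (i) : p' i = p (σ i) := by
    simpa [hu, hu', hQrow, hQ'row, hstat, hstat'] using (hac i u u).symm
  refine ⟨σ, hσ, fun i j => ?_, hpp⟩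
  have hrow (z) : ∑ j, Q (σ i) (σ j) * m (σ j) z = ∑ j, Q' i j * m (σ j) z := by
    have hz := hac i u z
    simp only [hu, hu', mul_one, hstat, hstat'] at hz
    rw [hpp] at hz
    have hz := mul_left_cancel₀ (hp _) hz
    rw [← Equiv.sum_comp σ] at hz
    simpa only [hσ] using hz
  have hli := hm.comp σ σ.injective
  rw [Fintype.linearIndependent_iff] at hli
  refine (sub_eq_zero.1 (hli (fun j => Q (σ i) (σ j) - Q' i j) ?_ j)).symm
  ext z
  simpa [sub_mul, sub_eq_zero] using hrow z

instance isFiniteMeasure_sum_ofReal_smul {ι Ω : Type*} [Fintype ι] [MeasurableSpace Ω]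
    (ν : ι → Measure Ω) [∀ i, IsFiniteMeasure (ν i)] (w : ι → ℝ) :
    IsFiniteMeasure (∑ i, ENNReal.ofReal (w i) • ν i) := by
  refine ⟨?_⟩
  simp only [Measure.coe_finsetSum, Finset.sum_apply, Measure.smul_apply, smul_eq_mul]
  exact ENNReal.sum_lt_top.2 fun i _ => by finiteness

theorem measureReal_sum_ofReal_smul {ι Ω : Type*} [Fintype ι] [MeasurableSpace Ω]
    (ν : ι → Measure Ω) [∀ i, IsFiniteMeasure (ν i)] {w : ι → ℝ} (hw : ∀ i, 0 ≤ w i) (s : Set Ω) :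
    (∑ i, ENNReal.ofReal (w i) • ν i).real s = ∑ i, w i * (ν i).real s := by
  simp only [Measure.real, Measure.coe_finsetSum, Finset.sum_apply, Measure.smul_apply,
    smul_eq_mul]
  rw [ENNReal.toReal_sum fun i _ => ENNReal.mul_ne_top ENNReal.ofReal_ne_top (by finiteness)]
  simp [ENNReal.toReal_mul, ENNReal.toReal_ofReal, hw]

theorem measureReal_sum_prod_prod {ι Ω : Type*} [Fintype ι] [MeasurableSpace Ω]
    (α β γ : ι → Measure Ω) [∀ i, IsFiniteMeasure (α i)] [∀ i, IsFiniteMeasure (β i)]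
    [∀ i, IsFiniteMeasure (γ i)] (A B C : Set Ω) :
    (∑ i, (α i).prod ((β i).prod (γ i))).real (A ×ˢ B ×ˢ C) =
      ∑ i, (α i).real A * (β i).real B * (γ i).real C := by
  simp only [Measure.real, Measure.coe_finsetSum, Finset.sum_apply, Measure.prod_prod]
  rw [ENNReal.toReal_sum fun i _ => by finiteness]
  simp [ENNReal.toReal_mul, mul_assoc]

theorem linearIndependent_measureReal {ι Ω : Type*} [Fintype ι] [MeasurableSpace Ω]
    {ν : ι → Measure Ω} [∀ i, IsFiniteMeasure (ν i)]
    (h : LinearIndependent ℝ fun i => (ν i).toSignedMeasure) :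
    LinearIndependent ℝ fun i (s : {s : Set Ω // MeasurableSet s}) => (ν i).real s := by
  rw [Fintype.linearIndependent_iff] at h ⊢
  refine fun g hg => h g (VectorMeasure.ext fun s hs => ?_)
  have := congrFun hg ⟨s, hs⟩
  simpa [FunLike.coe_sum, Measure.toSignedMeasure_apply_measurable hs] using this

/-- Proposition 1 of the paper: identifiability of HMMs whose emission
distributions are mixtures `μ j = ∑ ℓ, ψ j ℓ • φ ℓ` of linearly independent
distributions `φ ℓ`, with mixing matrix `ψ` of rank `k` and transition matrix
`Q` of full rank, from the law of three consecutive observations, up to label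
swapping. -/
theorem hmm_mixture_identifiability
    (k m : ℕ) (hk : 1 ≤ k) (hkm : k ≤ m)
    -- the mixture components and mixing matrix
    (φ : Fin m → Measure ℝ) [∀ ℓ, IsProbabilityMeasure (φ ℓ)]
    (hφli : LinearIndependent ℝ fun ℓ => (φ ℓ).toSignedMeasure)
    (ψ : Matrix (Fin k) (Fin m) ℝ)
    (hψnn : ∀ j ℓ, 0 ≤ ψ j ℓ) (hψrow : ∀ j, ∑ ℓ, ψ j ℓ = 1)
    (hψrank : ψ.rank = k)
    (μ : Fin k → Measure ℝ)
    (hμdef : ∀ j, μ j = ∑ ℓ, ENNReal.ofReal (ψ j ℓ) • φ ℓ)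
    -- the true transition matrix and stationary law
    (Q : Matrix (Fin k) (Fin k) ℝ)
    (hQnn : ∀ i j, 0 ≤ Q i j) (hQrow : ∀ i, ∑ j, Q i j = 1)
    (hQrank : Q.det ≠ 0)
    (π : Fin k → ℝ) (hπpos : ∀ j, 0 < π j) (hπsum : ∑ j, π j = 1)
    (hπstat : ∀ i, ∑ j, π j * Q j i = π i)
    -- the alternative parameters
    (Q' : Matrix (Fin k) (Fin k) ℝ)
    (hQ'nn : ∀ i j, 0 ≤ Q' i j) (hQ'row : ∀ i, ∑ j, Q' i j = 1)
    (π' : Fin k → ℝ) (hπ'nn : ∀ j, 0 ≤ π' j) (hπ'sum : ∑ j, π' j = 1)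
    (hπ'stat : ∀ i, ∑ j, π' j * Q' j i = π' i)
    (μ' : Fin k → Measure ℝ) [∀ i, IsProbabilityMeasure (μ' i)]
    -- equality of the laws of three consecutive observations
    (heq :
      (∑ i, ((∑ j, ENNReal.ofReal (π j * Q j i) • μ j).prod
        ((μ i).prod (∑ j, ENNReal.ofReal (Q i j) • μ j)))) =
      (∑ i, ((∑ j, ENNReal.ofReal (π' j * Q' j i) • μ' j).prod
        ((μ' i).prod (∑ j, ENNReal.ofReal (Q' i j) • μ' j))))) :
    ∃ σ : Equiv.Perm (Fin k),
      (∀ i, μ' i = μ (σ i)) ∧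
      (∀ i j, Q' i j = Q (σ i) (σ j)) ∧
      (∀ i, π' i = π (σ i)) := by
  have hrow : LinearIndependent ℝ ψ.row := by
    rw [linearIndependent_iff_card_eq_finrank_span]
    rw [Matrix.rank_eq_finrank_span_row] at hψrank
    exact (Fintype.card_fin k).trans hψrank.symm
  have : ∀ j, IsFiniteMeasure (μ j) := fun j => by
    rw [hμdef]
    infer_instance
  have hm : LinearIndependent ℝ fun j (s : {s : Set ℝ // MeasurableSet s}) => (μ j).real s := by
    simpa only [hμdef, measureReal_sum_ofReal_smul φ (hψnn _)] using
      (linearIndependent_measureReal hφli).sum_mul_of_row hrow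
  have hu (j) : (μ j).real Set.univ = 1 := by
    simp [hμdef, measureReal_sum_ofReal_smul φ (hψnn j), hψrow]
  have h (x y z : {s : Set ℝ // MeasurableSet s}) :
      ∑ i, (∑ j, π j * Q j i * (μ j).real x) * (μ i).real y * (∑ j, Q i j * (μ j).real z) =
        ∑ i, (∑ j, π' j * Q' j i * (μ' j).real x) * (μ' i).real y *
          (∑ j, Q' i j * (μ' j).real z) := by
    have hfin (i) : IsFiniteMeasure (∑ j, ENNReal.ofReal (Q i j) • μ j) :=
      isFiniteMeasure_sum_ofReal_smul μ fun j => Q i j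
    have hfin_alt (i) : IsFiniteMeasure (∑ j, ENNReal.ofReal (Q' i j) • μ' j) :=
      isFiniteMeasure_sum_ofReal_smul μ' fun j => Q' i j
    have h := congrArg (fun ν => Measure.real ν ((x : Set ℝ) ×ˢ (y : Set ℝ) ×ˢ (z : Set ℝ))) heq
    rw [measureReal_sum_prod_prod (fun i => ∑ j, ENNReal.ofReal (π j * Q j i) • μ j) μ
      (fun i => ∑ j, ENNReal.ofReal (Q i j) • μ j), measureReal_sum_prod_prod
      (fun i => ∑ j, ENNReal.ofReal (π' j * Q' j i) • μ' j) μ'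
      (fun i => ∑ j, ENNReal.ofReal (Q' i j) • μ' j)] at h
    simpa only [measureReal_sum_ofReal_smul _ (hQnn _), measureReal_sum_ofReal_smul _ (hQ'nn _),
      measureReal_sum_ofReal_smul μ fun j => mul_nonneg (hπpos j).le (hQnn j _),
      measureReal_sum_ofReal_smul μ' fun j => mul_nonneg (hπ'nn j) (hQ'nn j _)] using h
  obtain ⟨σ, hσ, hQσ, hπσ⟩ := hmm_identifiability_of_linearIndependent
    (m' := fun i (s : {s : Set ℝ // MeasurableSet s}) => (μ' i).real s)
    (u := ⟨Set.univ, MeasurableSet.univ⟩) hm hu (by simp) hQrow hQrank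
    (fun j => (hπpos j).ne') hπstat hQ'row hπ'stat h
  refine ⟨σ, fun i => Measure.ext fun s hs => ?_, hQσ, hπσ⟩
  exact (measureReal_eq_measureReal_iff (by finiteness) (by finiteness)).1 (congrFun (hσ i) ⟨s, hs⟩)
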